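/- Let 1 ≤ t ≤ n, let G be a uniformly random matrix in F_2^{n×d}, let N = N_{Im(G),t} denote the number of vectors w ∈ F_2^n of Hamming weight exactly t satisfying wᵀG = 0, and set α = binom(n,t)·2^{-d} (assumed positive). Then Pr[ |N - α| ≤ α^{2/3} ] ≥ 1 - α^{-1/3}. -/

import Mathlib

open Finset
open scoped Classical

noncomputable section

/-- The character `(-1)^b` of a bit `b ∈ F_2`, valued in `ℝ`. -/
def chi (b : ZMod 2) : ℝ := (-1 : ℝ) ^ b.val

/-- The `F_2` inner product `⟨v,w⟩ = ∑ i, v i * w i`. -/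
def ip {n : ℕ} (v w : Fin n → ZMod 2) : ZMod 2 := ∑ i, v i * w i

/-- Hamming weight of a vector in `F_2^n`. -/
def wt {n : ℕ} (v : Fin n → ZMod 2) : ℕ := (univ.filter fun i => v i ≠ 0).card

/-- `bias(v) = (1/n) ∑ i, (-1)^(v i)`. -/
def bias {n : ℕ} (v : Fin n → ZMod 2) : ℝ := (∑ i, chi (v i)) / n

/-- `bias(S, x) = (1/|S|) ∑_{w ∈ S} (-1)^⟨w,x⟩`. -/
def biasS {n : ℕ} (S : Finset (Fin n → ZMod 2)) (x : Fin n → ZMod 2) : ℝ :=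
  (∑ w ∈ S, chi (ip w x)) / S.card

/-- `S_{t,n}`: the set of Hamming-weight-`t` vectors in `F_2^n`. -/
def sphere (n t : ℕ) : Finset (Fin n → ZMod 2) := univ.filter fun w => wt w = t

/-- Probability of an event under the uniform distribution on a finite type. -/
def probOf {α : Type*} [Fintype α] (P : α → Prop) : ℝ :=
  ((univ.filter P).card : ℝ) / (Fintype.card α : ℝ)

/-- `N_{Im(G),t}`: the number of weight-`t` vectors `w` with `wᵀG = 0`. -/
def numChecks {n d : ℕ} (t : ℕ) (G : Matrix (Fin n) (Fin d) (ZMod 2)) : ℕ :=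
  (univ.filter fun w : Fin n → ZMod 2 => wt w = t ∧ Matrix.vecMul w G = 0).card

lemma ZMod.two_eq_zero_or_one (a : ZMod 2) : a = 0 ∨ a = 1 := by
  revert a
  decide

/-- The sphere of radius `t` in `F_2^n` has `n.choose t` points. -/
lemma card_sphere (n t : ℕ) : (sphere n t).card = n.choose t := by
  have h : (sphere n t).card = (powersetCard t (univ : Finset (Fin n))).card := by
    refine card_bij' (fun w _ => univ.filter fun i => w i ≠ 0)
      (fun s _ i => if i ∈ s then 1 else 0) ?_ ?_ ?_ ?_
    · intro w hw
      simpa [sphere, wt, mem_powersetCard] using hw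
    · intro s hs
      simpa [sphere, wt, mem_powersetCard] using hs
    · intro w _
      funext i
      rcases ZMod.two_eq_zero_or_one (w i) with h | h <;> simp [h]
    · intro s _
      ext i
      simp
  simpa using h

/-- The kernel of a surjective homomorphism of finite groups has density `1 / |B|`. -/
lemma card_filter_eq_zero_mul_card {A B : Type*} [AddCommGroup A] [AddCommGroup B] [Fintype A]
    [Fintype B] (f : A →+ B) [DecidablePred fun a => f a = 0] (hf : Function.Surjective f) :
    (univ.filter fun a => f a = 0).card * Fintype.card B = Fintype.card A := by
  have h := f.ker.card_mul_index
  rw [AddSubgroup.index_ker, AddMonoidHom.range_eq_top.mpr hf, AddSubgroup.card_top,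
    Nat.card_eq_fintype_card, Nat.card_eq_fintype_card, Nat.card_eq_fintype_card] at h
  rw [← h, Fintype.card_subtype]
  simp [AddMonoidHom.mem_ker]

/-- The homomorphism `G ↦ wᵀG`. -/
def vecMulHom {n : ℕ} (d : ℕ) (w : Fin n → ZMod 2) :
    Matrix (Fin n) (Fin d) (ZMod 2) →+ (Fin d → ZMod 2) where
  toFun G := Matrix.vecMul w G
  map_zero' := Matrix.vecMul_zero w
  map_add' G H := Matrix.vecMul_add G H w

lemma vecMulHom_surjective {n : ℕ} (d : ℕ) {w : Fin n → ZMod 2} (hw : w ≠ 0) :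
    Function.Surjective (vecMulHom d w) := by
  obtain ⟨i, hi⟩ := Function.ne_iff.mp hw
  have hi : w i = 1 := (ZMod.two_eq_zero_or_one _).resolve_left hi
  intro a
  refine ⟨Matrix.vecMulVec (Pi.single i 1) a, ?_⟩
  simp [vecMulHom, Matrix.vecMul_vecMulVec, hi]

/-- Distinct nonzero vectors over `F_2` are separated by a linear functional. -/
lemma exists_dotProduct_eq_one_eq_zero {n : ℕ} {v w : Fin n → ZMod 2} (hv : v ≠ 0)
    (hvw : v ≠ w) : ∃ u : Fin n → ZMod 2, v ⬝ᵥ u = 1 ∧ w ⬝ᵥ u = 0 := by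
  by_cases h : ∃ i, v i = 1 ∧ w i = 0
  · obtain ⟨i, hvi, hwi⟩ := h
    exact ⟨Pi.single i 1, by simp [hvi], by simp [hwi]⟩
  · push Not at h
    obtain ⟨i, hi⟩ := Function.ne_iff.mp hv
    have hvi : v i = 1 := (ZMod.two_eq_zero_or_one _).resolve_left hi
    have hwi : w i = 1 := (ZMod.two_eq_zero_or_one _).resolve_left (h i hvi)
    obtain ⟨j, hj⟩ := Function.ne_iff.mp hvw
    have hvj : v j = 0 := by
      refine (ZMod.two_eq_zero_or_one _).resolve_right fun hvj => hj ?_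
      rw [hvj, (ZMod.two_eq_zero_or_one _).resolve_left (h j hvj)]
    have hwj : w j = 1 :=
      (ZMod.two_eq_zero_or_one _).resolve_left fun hwj => hj (hvj.trans hwj.symm)
    refine ⟨Pi.single i 1 + Pi.single j 1, by simp [hvi, hvj], ?_⟩
    simp only [dotProduct_add, dotProduct_single, hwi, hwj]
    decide

lemma vecMulHom_prod_surjective {n : ℕ} (d : ℕ) {v w : Fin n → ZMod 2} (hv : v ≠ 0) (hw : w ≠ 0)
    (hvw : v ≠ w) : Function.Surjective ((vecMulHom d v).prod (vecMulHom d w)) := by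
  obtain ⟨x, hvx, hwx⟩ := exists_dotProduct_eq_one_eq_zero hv hvw
  obtain ⟨y, hwy, hvy⟩ := exists_dotProduct_eq_one_eq_zero hw hvw.symm
  rintro ⟨a, b⟩
  refine ⟨Matrix.vecMulVec x a + Matrix.vecMulVec y b, ?_⟩
  simp [vecMulHom, Matrix.vecMul_add, Matrix.vecMul_vecMulVec, hvx, hwx, hvy, hwy]

/-- A nonzero vector is a parity check of a uniformly random matrix with probability `2^{-d}`. -/
lemma card_vecMul_eq_zero {n : ℕ} (d : ℕ) {w : Fin n → ZMod 2} (hw : w ≠ 0) :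
    ((univ.filter fun G : Matrix (Fin n) (Fin d) (ZMod 2) => Matrix.vecMul w G = 0).card : ℝ) =
      Fintype.card (Matrix (Fin n) (Fin d) (ZMod 2)) * (2 : ℝ) ^ (-(d : ℤ)) := by
  have h : (univ.filter fun G : Matrix (Fin n) (Fin d) (ZMod 2) => Matrix.vecMul w G = 0).card *
      Fintype.card (Fin d → ZMod 2) = Fintype.card (Matrix (Fin n) (Fin d) (ZMod 2)) :=
    card_filter_eq_zero_mul_card (vecMulHom d w) (vecMulHom_surjective d hw)
  rw [← h]
  simp only [Fintype.card_fun, ZMod.card, Fintype.card_fin]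
  push_cast
  rw [zpow_neg, zpow_natCast]
  field_simp

/-- Two distinct nonzero vectors are simultaneously parity checks of a uniformly random matrix
with probability `2^{-2d}`. -/
lemma card_vecMul_eq_zero_and {n : ℕ} (d : ℕ) {v w : Fin n → ZMod 2} (hv : v ≠ 0) (hw : w ≠ 0)
    (hvw : v ≠ w) :
    ((univ.filter fun G : Matrix (Fin n) (Fin d) (ZMod 2) =>
        Matrix.vecMul v G = 0 ∧ Matrix.vecMul w G = 0).card : ℝ) =
      Fintype.card (Matrix (Fin n) (Fin d) (ZMod 2)) * ((2 : ℝ) ^ (-(d : ℤ))) ^ 2 := by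
  have h := card_filter_eq_zero_mul_card _ (vecMulHom_prod_surjective d hv hw hvw)
  rw [← h]
  simp only [vecMulHom, AddMonoidHom.prod_apply, AddMonoidHom.coe_mk, ZeroHom.coe_mk,
    Prod.mk_eq_zero, Fintype.card_prod, Fintype.card_fun, ZMod.card, Fintype.card_fin]
  push_cast
  rw [zpow_neg, zpow_natCast]
  field_simp

lemma ne_zero_of_mem_hamming_sphere {n t : ℕ} (ht : 1 ≤ t) {w : Fin n → ZMod 2} (hw : w ∈ sphere n t) :
    w ≠ 0 := by
  rintro rfl
  simp [sphere, wt] at hw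
  omega

lemma numChecks_eq_sum {n d : ℕ} (t : ℕ) (G : Matrix (Fin n) (Fin d) (ZMod 2)) :
    (numChecks t G : ℝ) = ∑ w ∈ sphere n t, if Matrix.vecMul w G = 0 then 1 else 0 := by
  rw [numChecks, sphere, sum_boole, filter_filter]

lemma sum_numChecks {n d t : ℕ} (ht : 1 ≤ t) :
    ∑ G : Matrix (Fin n) (Fin d) (ZMod 2), (numChecks t G : ℝ) =
      Fintype.card (Matrix (Fin n) (Fin d) (ZMod 2)) *
        ((n.choose t : ℝ) * (2 : ℝ) ^ (-(d : ℤ))) := by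
  simp_rw [numChecks_eq_sum]
  rw [sum_comm]
  simp_rw [sum_boole]
  rw [sum_congr rfl fun w hw => card_vecMul_eq_zero d (ne_zero_of_mem_hamming_sphere ht hw), sum_const,
    card_sphere, nsmul_eq_mul]
  ring

lemma sum_numChecks_sq_le {n d t : ℕ} (ht : 1 ≤ t) (α : ℝ)
    (hα : α = (n.choose t : ℝ) * (2 : ℝ) ^ (-(d : ℤ))) :
    ∑ G : Matrix (Fin n) (Fin d) (ZMod 2), (numChecks t G : ℝ) ^ 2 ≤
      Fintype.card (Matrix (Fin n) (Fin d) (ZMod 2)) * (α + α ^ 2) := by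
  set M : ℝ := (Fintype.card (Matrix (Fin n) (Fin d) (ZMod 2)) : ℝ)
  set q : ℝ := (2 : ℝ) ^ (-(d : ℤ))
  have hM : 0 ≤ M := Nat.cast_nonneg _
  calc ∑ G : Matrix (Fin n) (Fin d) (ZMod 2), (numChecks t G : ℝ) ^ 2
      = ∑ v ∈ sphere n t, ∑ w ∈ sphere n t,
          ((univ.filter fun G : Matrix (Fin n) (Fin d) (ZMod 2) =>
            Matrix.vecMul v G = 0 ∧ Matrix.vecMul w G = 0).card : ℝ) := by
        simp_rw [numChecks_eq_sum, sq, sum_mul_sum]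
        rw [sum_comm]
        refine sum_congr rfl fun v _ => ?_
        rw [sum_comm]
        refine sum_congr rfl fun w _ => ?_
        rw [← sum_boole]
        refine sum_congr rfl fun G _ => ?_
        rw [ite_and, ite_mul, one_mul, zero_mul]
    _ ≤ ∑ v ∈ sphere n t, ∑ w ∈ sphere n t, ((if v = w then M * q else 0) + M * q ^ 2) := by
        refine sum_le_sum fun v hv => sum_le_sum fun w hw => ?_
        have hv := ne_zero_of_mem_hamming_sphere ht hv
        have hw := ne_zero_of_mem_hamming_sphere ht hw
        by_cases h : v = w
        · subst h
          simp only [and_self, if_true]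
          rw [card_vecMul_eq_zero d hv]
          exact le_add_of_nonneg_right (by positivity)
        · rw [if_neg h, zero_add, card_vecMul_eq_zero_and d hv hw h]
    _ = M * (α + α ^ 2) := by
        simp_rw [sum_add_distrib, sum_ite_eq]
        rw [sum_ite_mem, inter_self]
        simp only [sum_const, card_sphere, nsmul_eq_mul, hα]
        ring

lemma sum_numChecks_sub_sq_le {n d t : ℕ} (ht : 1 ≤ t) (α : ℝ)
    (hα : α = (n.choose t : ℝ) * (2 : ℝ) ^ (-(d : ℤ))) :
    ∑ G : Matrix (Fin n) (Fin d) (ZMod 2), ((numChecks t G : ℝ) - α) ^ 2 ≤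
      Fintype.card (Matrix (Fin n) (Fin d) (ZMod 2)) * α := by
  have h1 := sum_numChecks (n := n) (d := d) ht
  rw [← hα] at h1
  have h2 := sum_numChecks_sq_le ht α hα
  simp_rw [sub_sq, sum_add_distrib, sum_sub_distrib, ← sum_mul, ← mul_sum]
  rw [h1, sum_const, card_univ, nsmul_eq_mul]
  linarith

/-- Chebyshev's inequality for the uniform distribution on a finite type. -/
lemma one_sub_le_probOf_abs_le {A : Type*} [Fintype A] [Nonempty A] (f : A → ℝ) {r V : ℝ}
    (hr : 0 < r) (hV : ∑ a, f a ^ 2 ≤ Fintype.card A * V) :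
    1 - V / r ^ 2 ≤ probOf fun a => |f a| ≤ r := by
  have hA : (0 : ℝ) < Fintype.card A := Nat.cast_pos.mpr Fintype.card_pos
  have hcard : ((univ.filter fun a => |f a| ≤ r).card : ℝ) +
      (univ.filter fun a => ¬ |f a| ≤ r).card = Fintype.card A := by
    exact_mod_cast card_filter_add_card_filter_not (s := (univ : Finset A)) fun a => |f a| ≤ r
  have hmarkov : ((univ.filter fun a => ¬ |f a| ≤ r).card : ℝ) * r ^ 2 ≤ Fintype.card A * V := by
    refine le_trans ?_ hV
    rw [← nsmul_eq_mul]
    refine (card_nsmul_le_sum _ (fun a => f a ^ 2) _ fun a ha => ?_).trans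
      (sum_le_sum_of_subset_of_nonneg (filter_subset _ _) fun a _ _ => sq_nonneg _)
    rw [← sq_abs (f a)]
    exact pow_le_pow_left₀ hr.le (not_le.mp (mem_filter.mp ha).2).le 2
  rw [probOf, le_div_iff₀ hA, sub_mul, one_mul, ← hcard, hcard]
  have : ((univ.filter fun a => ¬ |f a| ≤ r).card : ℝ) ≤ V / r ^ 2 * Fintype.card A := by
    rw [div_mul_eq_mul_div, le_div_iff₀ (by positivity), mul_comm V]
    exact hmarkov
  linarith

/-- For `1 ≤ t ≤ n`, uniformly random `G ∈ F_2^{n×d}`, and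
`α = binom(n,t)·2^{-d} > 0`, we have `Pr[ |N - α| ≤ α^{2/3} ] ≥ 1 - α^{-1/3}`. -/
theorem numChecks_concentration {n d : ℕ} (t : ℕ) (ht1 : 1 ≤ t) (ht2 : t ≤ n)
    (α : ℝ) (hα : α = (n.choose t : ℝ) * (2 : ℝ) ^ (-(d : ℤ))) (hαpos : 0 < α) :
    1 - α ^ (-(1 : ℝ) / 3) ≤
      probOf (fun G : Matrix (Fin n) (Fin d) (ZMod 2) =>
        |(numChecks t G : ℝ) - α| ≤ α ^ ((2 : ℝ) / 3)) := by
  have h := one_sub_le_probOf_abs_le (fun G : Matrix (Fin n) (Fin d) (ZMod 2) =>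
    (numChecks t G : ℝ) - α) (Real.rpow_pos_of_pos hαpos (2 / 3))
    (sum_numChecks_sub_sq_le ht1 α hα)
  have hpow : α / (α ^ ((2 : ℝ) / 3)) ^ 2 = α ^ (-(1 : ℝ) / 3) := by
    rw [← Real.rpow_mul_natCast hαpos.le]
    nth_rewrite 1 [← Real.rpow_one α]
    rw [← Real.rpow_sub hαpos]
    norm_num
  rwa [hpow] at h
end
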